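/- For n≥1 define f_n:[0,1]→[0,1] by f_n(x)=((2n+4)/(4+n))·x for x∈[0,(4+n)/(2n+4)] and f_n(x)=((2n+4)/n)·(1−x) for x∈[(4+n)/(2n+4),1]. Then the unimodal nonautonomous discrete dynamical system ([0,1],(f_n)_{n≥1}) satisfies the limit property, with uniform limit the full tent map f(x)=2x for x∈[0,1/2], f(x)=2(1−x) for x∈[1/2,1]: (i) f_n converges uniformly to f on [0,1]; (ii) the turning point 1/2 of f is not periodic; (iii) 𝒞_n((f_n)) is dense in [0,1] for every n≥1; (iv) 𝒞(f) is dense in [0,1]. -/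

import Mathlib

open Set

noncomputable section

/-- The nonautonomous iterate `f_n^ℓ = f_{n+ℓ-1} ∘ ⋯ ∘ f_n` (and `f_n^0 = id`). -/
def iterFrom (f : ℕ → ℝ → ℝ) : ℕ → ℕ → ℝ → ℝ
  | _, 0, x => x
  | n, ℓ + 1, x => f (n + ℓ) (iterFrom f n ℓ x)

/-- `f_n(x) = ((2n+4)/(4+n))·x` on `[0,(4+n)/(2n+4)]` and
`f_n(x) = ((2n+4)/n)·(1-x)` on `[(4+n)/(2n+4),1]`. -/
def fEx (n : ℕ) (x : ℝ) : ℝ :=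
  if x ≤ (4 + (n : ℝ)) / (2 * n + 4) then ((2 * (n : ℝ) + 4) / (4 + n)) * x
  else ((2 * (n : ℝ) + 4) / n) * (1 - x)

/-- The turning point `(4+n)/(2n+4)` of `f_n`. -/
def cEx (n : ℕ) : ℝ := (4 + (n : ℝ)) / (2 * n + 4)

/-- The full tent map `f(x) = 2x` on `[0,1/2]`, `f(x) = 2(1-x)` on `[1/2,1]`. -/
def tent (x : ℝ) : ℝ := if x ≤ (1 : ℝ) / 2 then 2 * x else 2 * (1 - x)

/-- The unimodal map of `[0,1]` that is affine on each side of `c` and takes `c` to `1`. -/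
def skewTent (c x : ℝ) : ℝ := if x ≤ c then x / c else (1 - x) / (1 - c)

theorem iterFrom_succ' (f : ℕ → ℝ → ℝ) (n ℓ : ℕ) (x : ℝ) :
    iterFrom f n (ℓ + 1) x = iterFrom f (n + 1) ℓ (f n x) := by
  induction ℓ with
  | zero => rfl
  | succ ℓ ih =>
    rw [iterFrom, ih, iterFrom, show n + (ℓ + 1) = n + 1 + ℓ by omega]

theorem iterFrom_const (g : ℝ → ℝ) (n ℓ : ℕ) (x : ℝ) :
    iterFrom (fun _ => g) n ℓ x = g^[ℓ] x := by
  induction ℓ with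
  | zero => rfl
  | succ ℓ ih => rw [iterFrom, ih, Function.iterate_succ_apply']

/-- An interval longer than `r ^ ℓ` contains a precritical point, since each branch of each map
expands by a factor at least `r⁻¹`. -/
theorem exists_precritical_of_pow_lt {f : ℕ → ℝ → ℝ} {c : ℕ → ℝ} {r : ℝ} (hr : r < 1)
    (hc : ∀ n, 1 ≤ n → 1 - r ≤ c n ∧ c n ≤ r) (hf : ∀ n, 1 ≤ n → f n = skewTent (c n))
    (ℓ : ℕ) : ∀ n, 1 ≤ n → ∀ u v : ℝ, 0 ≤ u → v ≤ 1 → r ^ ℓ < v - u →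
      ∃ x ∈ Icc u v, ∃ k, iterFrom f n k x = c (n + k) := by
  induction ℓ with
  | zero =>
    intro n _ u v hu hv h
    rw [pow_zero] at h
    linarith
  | succ ℓ ih =>
    intro n hn u v hu hv h
    obtain ⟨hc₁, hc₂⟩ := hc n hn
    have hc₀ : 0 < c n := by linarith
    have hc₃ : 0 < 1 - c n := by linarith
    have hrpos : 0 < r := by linarith
    have hrl : 0 < r ^ ℓ := pow_pos hrpos ℓ
    have huv : u < v := by linarith [pow_pos hrpos (ℓ + 1)]
    rw [pow_succ] at h
    by_cases h₁ : c n < u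
    · obtain ⟨y, ⟨hy₁, hy₂⟩, k, hk⟩ := ih (n + 1) (by omega) ((1 - v) / (1 - c n))
        ((1 - u) / (1 - c n)) (div_nonneg (by linarith) hc₃.le)
        ((div_le_one hc₃).2 (by linarith))
        (by rw [← sub_div, lt_div_iff₀ hc₃]; nlinarith)
      rw [div_le_iff₀ hc₃] at hy₁
      rw [le_div_iff₀ hc₃] at hy₂
      refine ⟨1 - y * (1 - c n), ⟨by linarith, by linarith⟩, k + 1, ?_⟩
      rw [iterFrom_succ', hf n hn, skewTent, if_neg (by linarith), sub_sub_cancel,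
        mul_div_cancel_right₀ _ hc₃.ne', hk, show n + 1 + k = n + (k + 1) by omega]
    by_cases h₂ : v < c n
    · obtain ⟨y, ⟨hy₁, hy₂⟩, k, hk⟩ := ih (n + 1) (by omega) (u / c n) (v / c n)
        (div_nonneg hu hc₀.le) ((div_le_one hc₀).2 h₂.le)
        (by rw [← sub_div, lt_div_iff₀ hc₀]; nlinarith)
      rw [div_le_iff₀ hc₀] at hy₁
      rw [le_div_iff₀ hc₀] at hy₂
      refine ⟨y * c n, ⟨hy₁, hy₂⟩, k + 1, ?_⟩
      rw [iterFrom_succ', hf n hn, skewTent, if_pos (by linarith),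
        mul_div_cancel_right₀ _ hc₀.ne', hk, show n + 1 + k = n + (k + 1) by omega]
    · exact ⟨c n, ⟨not_lt.1 h₁, not_lt.1 h₂⟩, 0, rfl⟩

theorem subset_closure_precritical {f : ℕ → ℝ → ℝ} {c : ℕ → ℝ} {r : ℝ} (hr : r < 1)
    (hc : ∀ n, 1 ≤ n → 1 - r ≤ c n ∧ c n ≤ r) (hf : ∀ n, 1 ≤ n → f n = skewTent (c n))
    {n : ℕ} (hn : 1 ≤ n) :
    Icc (0 : ℝ) 1 ⊆ closure {x ∈ Icc (0 : ℝ) 1 | ∃ k, iterFrom f n k x = c (n + k)} := by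
  rintro x ⟨hx₀, hx₁⟩
  refine Metric.mem_closure_iff.2 fun ε hε => ?_
  have huv : 0 < min 1 (x + ε / 2) - max 0 (x - ε / 2) := by
    rw [sub_pos, max_lt_iff, lt_min_iff, lt_min_iff]
    refine ⟨⟨?_, ?_⟩, ?_, ?_⟩ <;> linarith
  obtain ⟨ℓ, hℓ⟩ := exists_pow_lt_of_lt_one huv hr
  obtain ⟨y, ⟨hy₁, hy₂⟩, hy⟩ := exists_precritical_of_pow_lt hr hc hf ℓ n hn _ _
    (le_max_left _ _) (min_le_left _ _) hℓ
  rw [max_le_iff] at hy₁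
  rw [le_min_iff] at hy₂
  refine ⟨y, ⟨⟨hy₁.1, hy₂.1⟩, hy⟩, ?_⟩
  rw [Real.dist_eq, abs_lt]
  constructor <;> linarith

theorem tent_eq_skewTent : tent = skewTent (1 / 2) := by
  funext x
  simp only [tent, skewTent]
  split_ifs <;> ring

theorem one_sub_cEx (n : ℕ) : 1 - cEx n = n / (2 * n + 4) := by
  rw [cEx]
  field_simp
  ring

theorem fEx_eq_skewTent (n : ℕ) : fEx n = skewTent (cEx n) := by
  funext x
  rw [skewTent, one_sub_cEx, fEx, cEx]
  simp only [div_div_eq_mul_div, div_mul_eq_mul_div, mul_comm x, mul_comm (1 - x)]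

theorem cEx_bounds {n : ℕ} (hn : 1 ≤ n) : 1 - 5 / 6 ≤ cEx n ∧ cEx n ≤ 5 / 6 := by
  have h : (1 : ℝ) ≤ n := by exact_mod_cast hn
  rw [cEx, le_div_iff₀ (by positivity), div_le_iff₀ (by positivity)]
  constructor <;> linarith

theorem abs_skewTent_sub_tent_le {c x : ℝ} (hc : 1 / 2 ≤ c) (hc₁ : c < 1)
    (hx : x ∈ Icc (0 : ℝ) 1) : |tent x - skewTent c x| ≤ 2 * c - 1 := by
  obtain ⟨hx₀, hx₁⟩ := hx
  have hc₀ : 0 < c := by linarith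
  have hc₂ : 0 < 1 - c := by linarith
  rw [tent, skewTent, abs_le]
  split_ifs with h₁ h₂ h₂
  · have e : x / c * c = x := div_mul_cancel₀ x hc₀.ne'
    have h₃ : x / c ≤ 2 * x := by rw [div_le_iff₀ hc₀]; nlinarith
    have h₄ : 2 * x - (2 * c - 1) ≤ x / c := by rw [le_div_iff₀ hc₀]; nlinarith
    constructor <;> linarith
  · linarith
  · have h₃ : x / c ≤ 1 := (div_le_one hc₀).2 h₂
    have h₄ : 2 * (1 - x) - (2 * c - 1) ≤ x / c := by rw [le_div_iff₀ hc₀]; nlinarith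
    constructor <;> linarith
  · have h₃ : (1 - x) / (1 - c) ≤ 2 * (1 - x) + (2 * c - 1) := by
      rw [div_le_iff₀ hc₂]; nlinarith
    have h₄ : 2 * (1 - x) ≤ (1 - x) / (1 - c) := by rw [le_div_iff₀ hc₂]; nlinarith
    constructor <;> linarith

theorem two_mul_cEx_sub_one (n : ℕ) : 2 * cEx n - 1 = 2 / (n + 2) := by
  rw [cEx]
  field_simp
  ring

theorem tendstoUniformlyOn_fEx :
    TendstoUniformlyOn (fun n => fEx n) tent Filter.atTop (Icc (0:ℝ) 1) := by
  refine Metric.tendstoUniformlyOn_iff.2 fun ε hε => ?_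
  obtain ⟨N, hN⟩ := exists_nat_gt (2 / ε)
  filter_upwards [Filter.eventually_ge_atTop (max N 1)] with n hn x hx
  have hnN : (N : ℝ) ≤ n := by exact_mod_cast (le_max_left _ _).trans hn
  have hpos : (0 : ℝ) < 2 / (n + 2) := by positivity
  have hlt : (2 : ℝ) / (n + 2) < ε := by
    rw [div_lt_iff₀ hε] at hN
    rw [div_lt_iff₀ (by positivity)]
    nlinarith
  have hc := two_mul_cEx_sub_one n
  rw [Real.dist_eq, fEx_eq_skewTent]
  refine (abs_skewTent_sub_tent_le (by linarith) ?_ hx).trans_lt (hc.trans_lt hlt)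
  linarith [(cEx_bounds ((le_max_right N 1).trans hn)).2]

theorem tent_iterate_half_ne {m : ℕ} (hm : 1 ≤ m) : tent^[m] (1/2 : ℝ) ≠ 1/2 := by
  obtain ⟨m, rfl⟩ := Nat.exists_eq_add_of_le' hm
  have h₀ : tent 0 = 0 := by norm_num [tent]
  have h₁ : tent 1 = 0 := by norm_num [tent]
  have h₂ : tent (1 / 2) = 1 := by norm_num [tent]
  rw [Function.iterate_succ_apply, h₂]
  cases m with
  | zero => norm_num
  | succ m =>
    rw [Function.iterate_succ_apply, h₁, Function.iterate_fixed h₀]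
    norm_num

/-- The UNDS `([0,1], (f_n)_{n≥1})` satisfies the limit property, with uniform limit
the full tent map: (i) `f_n → tent` uniformly on `[0,1]`; (ii) the turning point `1/2`
of `tent` is not periodic; (iii) `𝒞_n((f_n))` is dense in `[0,1]` for every `n ≥ 1`;
(iv) `𝒞(tent)` is dense in `[0,1]`. -/
theorem fEx_limitProperty :
    TendstoUniformlyOn (fun n => fEx n) tent Filter.atTop (Icc (0:ℝ) 1) ∧
    (∀ m : ℕ, 1 ≤ m → tent^[m] (1/2 : ℝ) ≠ 1/2) ∧
    (∀ n : ℕ, 1 ≤ n →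
      Icc (0:ℝ) 1 ⊆
        closure {x ∈ Icc (0:ℝ) 1 | ∃ ℓ : ℕ, iterFrom fEx n ℓ x = cEx (n + ℓ)}) ∧
    Icc (0:ℝ) 1 ⊆ closure {x ∈ Icc (0:ℝ) 1 | ∃ ℓ : ℕ, tent^[ℓ] x = 1/2} := by
  refine ⟨tendstoUniformlyOn_fEx, fun m hm => tent_iterate_half_ne hm, fun n hn =>
    subset_closure_precritical (by norm_num) (fun _ h => cEx_bounds h)
      (fun k _ => fEx_eq_skewTent k) hn, ?_⟩
  simpa only [iterFrom_const] using
    subset_closure_precritical (f := fun _ => tent) (c := fun _ => 1 / 2) (r := 1 / 2)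
      (by norm_num) (fun _ _ => by norm_num) (fun _ _ => tent_eq_skewTent) le_rfl
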